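/- arXiv:0803.3747 — 2 statements merged into one kernel-verified Lean document; each statement's English description precedes it below -/
import Mathlib

section
/- Let a = X x for some x : σ and let u ∈ H satisfy ε(u) = 0. Then for every integer k ≥ 1, Δ̄ᵏ(a·u) = Σ_{i=1}^{k+1} Σ u⁽¹⁾ ⊗ ⋯ ⊗ u⁽ⁱ⁻¹⁾ ⊗ a ⊗ u⁽ⁱ⁾ ⊗ ⋯ ⊗ u⁽ᵏ⁾ + Σ_{i=1}^{k+1} Σ v⁽¹⁾ ⊗ ⋯ ⊗ v⁽ⁱ⁻¹⁾ ⊗ (a·v⁽ⁱ⁾) ⊗ v⁽ⁱ⁺¹⁾ ⊗ ⋯ ⊗ v⁽ᵏ⁺¹⁾, where in the first sum Δ̄ᵏ⁻¹u = Σ u⁽¹⁾ ⊗ ⋯ ⊗ u⁽ᵏ⁾ (the term a is inserted as a new i-th tensor factor, the cases i = 1 and i = k+1 giving a ⊗ Δ̄ᵏ⁻¹u and Δ̄ᵏ⁻¹u ⊗ a), and in the second sum Δ̄ᵏu = Σ v⁽¹⁾ ⊗ ⋯ ⊗ v⁽ᵏ⁺¹⁾ (a is multiplied into the i-th tensor factor).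 -/
/-! Statement 2: explicit form of the iterated reduced coproduct of `a·u`. -/

open MvPolynomial TensorProduct

noncomputable section

abbrev H (σ : Type) := MvPolynomial σ ℚ

/-- Model of the `k`-fold tensor power `H^{⊗k}`: the `i`-th tensor factor
corresponds to the variables `X (x, i)`. -/
abbrev Hpow (σ : Type) (k : ℕ) := MvPolynomial (σ × Fin k) ℚ

/-- The iterated coproduct `Δ^{k-1} : H → H^{⊗k}` (with `k` tensor factors),
i.e. the algebra map sending each `X x` to the sum of its copies in the `k` slots.
For `k = 2` this is the coproduct `Δ(X x) = X x ⊗ 1 + 1 ⊗ X x`. -/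
def DIter (σ : Type) (k : ℕ) : H σ →ₐ[ℚ] Hpow σ k :=
  aeval fun x => ∑ i : Fin k, X (x, i)

/-- Setting to `0` all variables lying in the slots of `S`; used to express the
projection `π = id - 1∘ε` on each tensor factor by inclusion–exclusion. -/
def zeroSlots (σ : Type) (k : ℕ) (S : Finset (Fin k)) : Hpow σ k →ₐ[ℚ] Hpow σ k :=
  aeval fun p => if p.2 ∈ S then 0 else X p

/-- The iterated reduced coproduct `Δ̄^{k-1} : H → H^{⊗k}` (with `k` tensor
factors): `Δ̄^{k-1} = π^{⊗k} ∘ Δ^{k-1}` where `π = id - 1∘ε`, written by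
inclusion–exclusion.  On the augmentation ideal `ker ε` (where all our
statements take place) this agrees with the recursively iterated reduced
coproduct `Δ̄u = Δu - 1 ⊗ u - u ⊗ 1`, `Δ̄ᵏ⁺¹ = (id^{⊗k} ⊗ Δ̄) ∘ Δ̄ᵏ`. -/
def DbarIter (σ : Type) (k : ℕ) : H σ →ₗ[ℚ] Hpow σ k :=
  (∑ S : Finset (Fin k), ((-1 : ℚ)) ^ S.card • (zeroSlots σ k S).toLinearMap) ∘ₗ
    (DIter σ k).toLinearMap

/-- A sum over the finsets of `Fin (k + 1)`, split according to membership of `i`. -/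
theorem sum_finset_fin_succ {M : Type*} [AddCommMonoid M] {k : ℕ} (i : Fin (k + 1))
    (f : Finset (Fin (k + 1)) → M) :
    ∑ S, f S = ∑ T : Finset (Fin k), f (T.map i.succAboveEmb) +
      ∑ T : Finset (Fin k), f (insert i (T.map i.succAboveEmb)) := by
  have hi : i ∉ (Finset.univ : Finset (Fin k)).map i.succAboveEmb := by simp
  have hp : ((Finset.univ : Finset (Fin k)).map i.succAboveEmb).powerset =
      Finset.univ.map (Finset.mapEmbedding i.succAboveEmb).toEmbedding := by
    ext S
    simp [Finset.subset_map_iff, eq_comm]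
  rw [← Finset.powerset_univ, Fin.univ_succAbove k i, Finset.cons_eq_insert,
    Finset.sum_powerset_insert hi, hp, Finset.sum_map, Finset.sum_map]
  rfl

theorem DbarIter_apply (σ : Type) (k : ℕ) (u : H σ) :
    DbarIter σ k u =
      ∑ S : Finset (Fin k), ((-1 : ℚ)) ^ S.card • zeroSlots σ k S (DIter σ k u) := by
  simp [DbarIter]

theorem zeroSlots_insert_DIter (σ : Type) {k : ℕ} (i : Fin (k + 1)) (T : Finset (Fin k))
    (u : H σ) :
    zeroSlots σ (k + 1) (insert i (T.map i.succAboveEmb)) (DIter σ (k + 1) u) =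
      rename (Prod.map id (Fin.succAbove i)) (zeroSlots σ k T (DIter σ k u)) := by
  suffices h : (zeroSlots σ (k + 1) (insert i (T.map i.succAboveEmb))).comp (DIter σ (k + 1)) =
      (rename (Prod.map id (Fin.succAbove i))).comp ((zeroSlots σ k T).comp (DIter σ k)) from
    DFunLike.congr_fun h u
  ext1 y
  simp [zeroSlots, DIter, Fin.sum_univ_succAbove _ i, apply_ite (rename _)]

theorem zeroSlots_DIter_X (σ : Type) (k : ℕ) (S : Finset (Fin k)) (x : σ) :
    zeroSlots σ k S (DIter σ k (X x)) = ∑ i : Fin k, if i ∈ S then 0 else X (x, i) := by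
  simp [zeroSlots, DIter]

/-- The terms of `DbarIter` for the slot sets avoiding `i`. -/
theorem sum_zeroSlots_notMem (σ : Type) {k : ℕ} (i : Fin (k + 1)) (u : H σ) :
    ∑ S : Finset (Fin (k + 1)),
        (if i ∈ S then 0 else ((-1 : ℚ)) ^ S.card • zeroSlots σ (k + 1) S (DIter σ (k + 1) u)) =
      rename (Prod.map id (Fin.succAbove i)) (DbarIter σ k u) + DbarIter σ (k + 1) u := by
  rw [DbarIter_apply σ (k + 1), sum_finset_fin_succ i, sum_finset_fin_succ i, DbarIter_apply]
  simp [zeroSlots_insert_DIter, Finset.card_insert_of_notMem, pow_succ, map_sum]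

/-- Lemma 3.1 (explicit form): for `a = X x`, `ε(u) = 0` and `k ≥ 1`,
`Δ̄ᵏ(a·u) = Σ_{i=1}^{k+1} Σ u⁽¹⁾ ⊗ ⋯ ⊗ u⁽ⁱ⁻¹⁾ ⊗ a ⊗ u⁽ⁱ⁾ ⊗ ⋯ ⊗ u⁽ᵏ⁾
          + Σ_{i=1}^{k+1} Σ v⁽¹⁾ ⊗ ⋯ ⊗ (a·v⁽ⁱ⁾) ⊗ ⋯ ⊗ v⁽ᵏ⁺¹⁾`,
where `Δ̄ᵏ⁻¹u = Σ u⁽¹⁾ ⊗ ⋯ ⊗ u⁽ᵏ⁾` and `Δ̄ᵏu = Σ v⁽¹⁾ ⊗ ⋯ ⊗ v⁽ᵏ⁺¹⁾`.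
In the model `Hpow σ (k+1)` of `H^{⊗(k+1)}`, inserting `a` as a new `i`-th
tensor factor of `Δ̄ᵏ⁻¹u` is `X (x, i) * rename (id × (Fin.succAbove i)) (Δ̄ᵏ⁻¹u)`
(the `k` old factors are moved to the slots other than `i` in an
order-preserving way), and multiplying `a` into the `i`-th factor of `Δ̄ᵏu`
is `X (x, i) * Δ̄ᵏu`. -/
theorem stmt2 (σ : Type) (x : σ) (u : H σ) (hu : constantCoeff u = 0)
    (k : ℕ) (hk : 1 ≤ k) :
    DbarIter σ (k + 1) (X x * u) =
      (∑ i : Fin (k + 1),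
          X (x, i) * rename (Prod.map id (Fin.succAbove i)) (DbarIter σ k u))
        + ∑ i : Fin (k + 1), X (x, i) * DbarIter σ (k + 1) u := by
  simp_rw [← Finset.sum_add_distrib, ← mul_add, ← sum_zeroSlots_notMem, Finset.mul_sum]
  rw [Finset.sum_comm, DbarIter_apply]
  refine Finset.sum_congr rfl fun S _ => ?_
  rw [map_mul, map_mul, zeroSlots_DIter_X, Finset.sum_mul, Finset.smul_sum]
  refine Finset.sum_congr rfl fun i _ => ?_
  split_ifs <;> simp

end
end

section
/- Convolution exponential and convolution logarithm are mutually inverse: for every unital form ρ on H one has e^{∗(log^{∗}ρ)} = ρ (in particular every unital form is the convolution exponential of its cumulant form, the algebraic form of the generalized Wick theorem), and for every infinitesimal form s one has log^{∗}(e^{∗s}) = s. -/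
/-! Statement 7: convolution exponential and logarithm are mutually inverse. -/

open MvPolynomial TensorProduct

noncomputable section

/-- The coproduct `Δ`, the algebra map determined by `Δ(X x) = X x ⊗ 1 + 1 ⊗ X x`. -/
def Delta (σ : Type) : H σ →ₐ[ℚ] (H σ) ⊗[ℚ] (H σ) :=
  aeval fun x => X x ⊗ₜ[ℚ] 1 + 1 ⊗ₜ[ℚ] X x

/-- A form is a ℚ-linear map `H → ℚ`. -/
abbrev Form (σ : Type) := MvPolynomial σ ℚ →ₗ[ℚ] ℚ

/-- The counit `ε`: the constant-coefficient map (evaluation of all variables at `0`). -/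
def counitF (σ : Type) : Form σ :=
  (aeval (R := ℚ) fun _ : σ => (0 : ℚ)).toLinearMap

/-- The convolution product of forms: `(ρ ∗ τ)(u) = Σ ρ(u₍₁₎) τ(u₍₂₎)`. -/
def conv {σ : Type} (ρ τ : Form σ) : Form σ :=
  (TensorProduct.lid ℚ ℚ).toLinearMap ∘ₗ (TensorProduct.map ρ τ) ∘ₗ (Delta σ).toLinearMap

/-- Convolution powers: `ρ^{∗0} = ε`, `ρ^{∗(n+1)} = ρ^{∗n} ∗ ρ`. -/
def convPow {σ : Type} (ρ : Form σ) : ℕ → Form σ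
  | 0 => counitF σ
  | n + 1 => conv (convPow ρ n) ρ

/-- The convolution exponential `e^{∗s} : u ↦ Σ_{n≥0} s^{∗n}(u)/n!`.  On each
`u` the sum is finite since `s^{∗n}(u) = 0` for `n > totalDegree u` when `s` is
infinitesimal; accordingly it is defined as the linear form whose value on the
basis monomial `X^d` (of total degree `Σ d`) is `Σ_{n=0}^{Σ d} s^{∗n}(X^d)/n!`. -/
def convExp {σ : Type} (s : Form σ) : Form σ :=
  (basisMonomials σ ℚ).constr ℚ fun d =>
    ∑ n ∈ Finset.range ((d.sum fun _ e => e) + 1),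
      ((n.factorial : ℚ))⁻¹ * convPow s n (monomial d 1)

/-- The convolution logarithm `log^{∗}ρ : u ↦ Σ_{n≥1} ((-1)^{n+1}/n)·(ρ-ε)^{∗n}(u)`,
a finite sum on each `u` since `(ρ-ε)^{∗n}(u) = 0` for `n > totalDegree u`. -/
def convLog {σ : Type} (ρ : Form σ) : Form σ :=
  (basisMonomials σ ℚ).constr ℚ fun d =>
    ∑ n ∈ Finset.Icc 1 (d.sum fun _ e => e),
      (((-1 : ℚ)) ^ (n + 1) / n) * convPow (ρ - counitF σ) n (monomial d 1)

namespace PowerSeries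

theorem derivative_log_mul_one_add_X : d⁄dX ℚ (log ℚ) * (1 + X) = 1 := by
  rw [deriv_log]
  ext n
  cases n with
  | zero => simp
  | succ n => simp [mul_add, coeff_succ_mul_X, coeff_one, pow_succ]

theorem log_subst_exp_sub_one : (log ℚ).subst (exp ℚ - 1) = (X : ℚ⟦X⟧) := by
  have hE : HasSubst (exp ℚ - 1) := HasSubst.exp_sub_one
  apply derivative.ext
  · have h := congrArg (subst (exp ℚ - 1)) derivative_log_mul_one_add_X
    have hX : (1 + X : ℚ⟦X⟧).subst (exp ℚ - 1) = exp ℚ := by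
      rw [subst_add hE, subst_X hE, ← coe_substAlgHom hE, map_one, add_sub_cancel]
    rw [subst_mul hE, hX, ← coe_substAlgHom hE, map_one, coe_substAlgHom] at h
    rw [derivative_subst hE, map_sub, derivative_exp, Derivation.map_one_eq_zero, sub_zero, h, derivative_X]
  · rw [← logOf_eq, ← coeff_zero_eq_constantCoeff_apply, coeff_zero_eq_constantCoeff_apply,
      constantCoeff_logOf (by simp)]
    simp

theorem exp_subst_log : (exp ℚ).subst (log ℚ) = (1 + X : ℚ⟦X⟧) := by
  have hL : HasSubst (log ℚ) := HasSubst.log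
  have hlog := derivative_log_mul_one_add_X
  have hF : d⁄dX ℚ ((exp ℚ).subst (log ℚ)) = (exp ℚ).subst (log ℚ) * d⁄dX ℚ (log ℚ) := by
    rw [derivative_subst hL, derivative_exp]
  have hlog' := congrArg (d⁄dX ℚ) hlog
  have hone : d⁄dX ℚ (1 : ℚ⟦X⟧) = 0 := Derivation.map_one_eq_zero _
  simp only [Derivation.leibniz, map_add, hone, derivative_X, smul_eq_mul] at hlog'
  have hc : constantCoeff ((exp ℚ).subst (log ℚ) : ℚ⟦X⟧) = 1 := by
    have h := constantCoeff_subst_eq_zero (a := log ℚ) constantCoeff_log (exp ℚ - 1) (by simp)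
    rw [subst_sub hL, ← coe_substAlgHom hL, map_one, map_sub, map_one, sub_eq_zero] at h
    rw [← coe_substAlgHom hL]
    exact h
  have hquot : (exp ℚ).subst (log ℚ) * d⁄dX ℚ (log ℚ) = (1 : ℚ⟦X⟧) := by
    apply derivative.ext
    · rw [Derivation.leibniz, hF, hone, smul_eq_mul, smul_eq_mul]
      linear_combination (exp ℚ).subst (log ℚ) * (d⁄dX ℚ (log ℚ) * hlog'
        - d⁄dX ℚ (d⁄dX ℚ (log ℚ)) * hlog)
    · simp [hc, deriv_log, ← coeff_zero_eq_constantCoeff_apply (mk _)]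
  linear_combination (1 + X) * hquot - (exp ℚ).subst (log ℚ) * hlog

theorem coeff_subst_eq_sum_range {τ : Type*} {a : MvPowerSeries τ ℚ}
    (ha : MvPowerSeries.constantCoeff a = 0) (f : ℚ⟦X⟧) (d : τ →₀ ℕ) :
    MvPowerSeries.coeff d (f.subst a) =
      ∑ n ∈ Finset.range (d.degree + 1), coeff n f * MvPowerSeries.coeff d (a ^ n) := by
  rw [coeff_subst (HasSubst.of_constantCoeff_zero ha)]
  apply finsum_eq_sum_of_support_subset
  intro n hn
  by_contra h
  refine hn ?_
  have hd : (d.degree : ℕ∞) < n := by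
    exact_mod_cast Nat.lt_of_succ_le
      (not_lt.mp fun hlt => h (Finset.mem_coe.mpr (Finset.mem_range.mpr hlt)))
  dsimp only
  rw [MvPowerSeries.coeff_of_lt_order
    (hd.trans_le (MvPowerSeries.le_order_pow_of_constantCoeff_eq_zero n ha)), smul_zero]

end PowerSeries

section ExponentialSeries

variable {σ : Type}

/-- The product `∏ dᵢ!` of the factorials of the entries of `d`. -/
def multiFactorial (d : σ →₀ ℕ) : ℚ := d.prod fun _ e => (e.factorial : ℚ)

theorem multiFactorial_ne_zero (d : σ →₀ ℕ) : multiFactorial d ≠ 0 :=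
  Finset.prod_ne_zero_iff.mpr fun _ _ => Nat.cast_ne_zero.mpr (Nat.factorial_ne_zero _)

theorem multiFactorial_add_single (d : σ →₀ ℕ) (x : σ) :
    multiFactorial (d + Finsupp.single x 1) = (d x + 1) * multiFactorial d := by
  classical
  have hsup : (d + Finsupp.single x 1).support ⊆ insert x d.support := by
    intro y hy
    by_cases hxy : y = x
    · simp [hxy]
    · simpa [Finsupp.single_apply, Ne.symm hxy, hxy] using hy
  rw [multiFactorial, multiFactorial, Finsupp.prod_of_support_subset _ hsup _ (by simp),
    Finsupp.prod_of_support_subset d (Finset.subset_insert x _) _ (by simp),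
    ← Finset.mul_prod_erase _ _ (Finset.mem_insert_self x _),
    ← Finset.mul_prod_erase _ _ (Finset.mem_insert_self x _), ← mul_assoc]
  congr 1
  · simp [Nat.factorial_succ]
  · refine Finset.prod_congr rfl fun y hy => ?_
    simp [(Finset.ne_of_mem_erase hy).symm]

/-- The exponential generating series `∑ ρ(X^d) / d! · X^d` of a form `ρ`. -/
def expSeries : Form σ →ₗ[ℚ] MvPowerSeries σ ℚ where
  toFun ρ := fun d => (multiFactorial d)⁻¹ * ρ (monomial d 1)
  map_add' ρ τ := by ext d; exact mul_add _ _ _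
  map_smul' c ρ := by ext d; exact mul_left_comm _ _ _

theorem coeff_expSeries (ρ : Form σ) (d : σ →₀ ℕ) :
    MvPowerSeries.coeff d (expSeries ρ) = (multiFactorial d)⁻¹ * ρ (monomial d 1) := rfl

theorem expSeries_injective : Function.Injective (expSeries (σ := σ)) := by
  intro ρ τ h
  refine (basisMonomials σ ℚ).ext fun d => ?_
  have hd := congrArg (MvPowerSeries.coeff d) h
  rw [coeff_expSeries, coeff_expSeries] at hd
  simpa using mul_left_cancel₀ (inv_ne_zero (multiFactorial_ne_zero d)) hd

theorem constantCoeff_expSeries (ρ : Form σ) :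
    MvPowerSeries.constantCoeff (expSeries ρ) = ρ 1 := by
  rw [← MvPowerSeries.coeff_zero_eq_constantCoeff_apply, coeff_expSeries]
  simp [multiFactorial]

theorem pderiv_expSeries (ρ : Form σ) (x : σ) :
    MvPowerSeries.pderiv ℚ x (expSeries ρ) =
      expSeries (ρ ∘ₗ LinearMap.mulLeft ℚ (X x)) := by
  ext d
  have hX : (X x : H σ) * monomial d 1 = monomial (d + Finsupp.single x 1) 1 := by
    rw [X, monomial_mul, one_mul, add_comm]
  have h0 : (d x + 1 : ℚ) ≠ 0 := by positivity
  rw [MvPowerSeries.coeff_pderiv, coeff_expSeries, coeff_expSeries, multiFactorial_add_single,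
    LinearMap.comp_apply, LinearMap.mulLeft_apply, hX]
  field_simp

theorem conv_comp_mulLeft_X (ρ τ : Form σ) (x : σ) :
    conv ρ τ ∘ₗ LinearMap.mulLeft ℚ (X x) =
      conv (ρ ∘ₗ LinearMap.mulLeft ℚ (X x)) τ + conv ρ (τ ∘ₗ LinearMap.mulLeft ℚ (X x)) := by
  refine LinearMap.ext fun u => ?_
  have key (z : H σ ⊗[ℚ] H σ) :
      TensorProduct.map ρ τ ((X x ⊗ₜ[ℚ] 1 + 1 ⊗ₜ[ℚ] X x) * z) =
        TensorProduct.map (ρ ∘ₗ LinearMap.mulLeft ℚ (X x)) τ z +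
          TensorProduct.map ρ (τ ∘ₗ LinearMap.mulLeft ℚ (X x)) z := by
    induction z with
    | zero => simp
    | tmul a b => simp [add_mul]
    | add a b ha hb => rw [mul_add, map_add, ha, hb, map_add, map_add]; abel
  have hΔ : Delta σ (X x * u) = (X x ⊗ₜ[ℚ] 1 + 1 ⊗ₜ[ℚ] X x) * Delta σ u := by
    rw [map_mul, Delta, aeval_X]
  simp [conv, hΔ, key]

theorem conv_apply_one (ρ τ : Form σ) : conv ρ τ 1 = ρ 1 * τ 1 := by
  simp [conv, Algebra.TensorProduct.one_def]

theorem expSeries_conv (ρ τ : Form σ) : expSeries (conv ρ τ) = expSeries ρ * expSeries τ := by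
  ext d
  induction hn : d.degree generalizing d ρ τ with
  | zero =>
    obtain rfl := (Finsupp.degree_eq_zero_iff d).mp hn
    simp only [MvPowerSeries.coeff_zero_eq_constantCoeff_apply, map_mul, constantCoeff_expSeries,
      conv_apply_one]
  | succ n ih =>
    obtain ⟨x, hx⟩ : ∃ x, d x ≠ 0 := by
      by_contra! h
      simp [show d = 0 from Finsupp.ext h] at hn
    obtain ⟨e, rfl⟩ : ∃ e, d = e + Finsupp.single x 1 :=
      ⟨d - Finsupp.single x 1, (tsub_add_cancel_of_le
        (Finsupp.single_le_iff.mpr (Nat.one_le_iff_ne_zero.mpr hx))).symm⟩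
    have he : e.degree = n := by simpa using hn
    have h0 : (e x + 1 : ℚ) ≠ 0 := by positivity
    refine mul_right_cancel₀ h0 ?_
    rw [← MvPowerSeries.coeff_pderiv, ← MvPowerSeries.coeff_pderiv, Derivation.leibniz,
      pderiv_expSeries, pderiv_expSeries, pderiv_expSeries, conv_comp_mulLeft_X, map_add, map_add,
      map_add, ih _ _ e he, ih _ _ e he, smul_eq_mul, smul_eq_mul, add_comm,
      mul_comm (expSeries τ)]

theorem expSeries_counitF : expSeries (counitF σ) = 1 := by
  classical
  ext d
  rw [coeff_expSeries, MvPowerSeries.coeff_one]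
  split_ifs with h
  · simp [h, counitF, multiFactorial]
  · obtain ⟨x, hx⟩ : ∃ x, d x ≠ 0 := by
      by_contra! h'
      exact h (Finsupp.ext h')
    have : (d.prod fun _ e => (0 : ℚ) ^ e) = 0 :=
      Finset.prod_eq_zero (Finsupp.mem_support_iff.mpr hx) (zero_pow hx)
    simp [counitF, aeval_monomial, this]

theorem expSeries_convPow (ρ : Form σ) (n : ℕ) : expSeries (convPow ρ n) = expSeries ρ ^ n := by
  induction n with
  | zero => rw [convPow, expSeries_counitF, pow_zero]
  | succ n ih => rw [convPow, expSeries_conv, ih, pow_succ]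

theorem expSeries_convExp {s : Form σ} (hs : s 1 = 0) :
    expSeries (convExp s) = (PowerSeries.exp ℚ).subst (expSeries s) := by
  ext d
  have h : convExp s (monomial d 1) = ∑ n ∈ Finset.range (d.degree + 1),
      ((n.factorial : ℚ))⁻¹ * convPow s n (monomial d 1) := by
    rw [← congrFun (coe_basisMonomials σ ℚ) d, convExp, Module.Basis.constr_basis]
    rfl
  rw [PowerSeries.coeff_subst_eq_sum_range ((constantCoeff_expSeries s).trans hs),
    coeff_expSeries, h, Finset.mul_sum]
  refine Finset.sum_congr rfl fun n _ => ?_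
  rw [← expSeries_convPow, coeff_expSeries, PowerSeries.coeff_exp, mul_left_comm]
  simp

theorem expSeries_convLog {ρ : Form σ} (hρ : ρ 1 = 1) :
    expSeries (convLog ρ) = (PowerSeries.log ℚ).subst (expSeries ρ - 1) := by
  ext d
  have hsub : expSeries ρ - 1 = expSeries (ρ - counitF σ) := by rw [map_sub, expSeries_counitF]
  have hc : MvPowerSeries.constantCoeff (expSeries ρ - 1) = 0 := by
    rw [map_sub, constantCoeff_expSeries, hρ, map_one, sub_self]
  have h : convLog ρ (monomial d 1) = ∑ n ∈ Finset.Icc 1 d.degree,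
      (((-1 : ℚ)) ^ (n + 1) / n) * convPow (ρ - counitF σ) n (monomial d 1) := by
    rw [← congrFun (coe_basisMonomials σ ℚ) d, convLog, Module.Basis.constr_basis]
    rfl
  rw [PowerSeries.coeff_subst_eq_sum_range hc, coeff_expSeries, h, Finset.mul_sum,
    Finset.range_eq_Ico, Finset.sum_eq_sum_Ico_succ_bot (Nat.succ_pos _)]
  simp only [PowerSeries.coeff_log, if_true, zero_mul, zero_add]
  refine Finset.sum_congr rfl fun n hn => ?_
  have hn0 : n ≠ 0 := Nat.one_le_iff_ne_zero.mp (Finset.mem_Icc.mp hn).1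
  rw [hsub, ← expSeries_convPow, coeff_expSeries, if_neg hn0, mul_left_comm]
  simp

end ExponentialSeries

/-- Convolution exponential and convolution logarithm are inverse functions of
each other: `e^{∗(log^{∗}ρ)} = ρ` for every unital form `ρ` (the algebraic form
of the generalized Wick theorem: every unital form is the convolution
exponential of its cumulant form), and `log^{∗}(e^{∗s}) = s` for every
infinitesimal form `s`. -/
theorem stmt7 (σ : Type) :
    (∀ ρ : Form σ, ρ 1 = 1 → convExp (convLog ρ) = ρ) ∧
    (∀ s : Form σ, s 1 = 0 → convLog (convExp s) = s) := by
  refine ⟨fun ρ hρ => expSeries_injective ?_, fun s hs => expSeries_injective ?_⟩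
  · have hc : MvPowerSeries.constantCoeff (expSeries ρ - 1) = 0 := by
      rw [map_sub, constantCoeff_expSeries, hρ, map_one, sub_self]
    have ha := PowerSeries.HasSubst.of_constantCoeff_zero hc
    have hlog : convLog ρ 1 = 0 := by
      rw [← constantCoeff_expSeries, expSeries_convLog hρ]
      exact PowerSeries.constantCoeff_subst_eq_zero hc _ PowerSeries.constantCoeff_log
    rw [expSeries_convExp hlog, expSeries_convLog hρ,
      ← PowerSeries.subst_comp_subst_apply PowerSeries.HasSubst.log ha,
      PowerSeries.exp_subst_log, ← PowerSeries.coe_substAlgHom ha, map_add, map_one,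
      PowerSeries.substAlgHom_X, add_sub_cancel]
  · have hc : MvPowerSeries.constantCoeff (expSeries s) = 0 :=
      (constantCoeff_expSeries s).trans hs
    have ha := PowerSeries.HasSubst.of_constantCoeff_zero hc
    have hsub : (PowerSeries.exp ℚ).subst (expSeries s) - 1 =
        (PowerSeries.exp ℚ - 1).subst (expSeries s) := by
      rw [← PowerSeries.coe_substAlgHom ha, map_sub, map_one]
    have hexp : convExp s 1 = 1 := by
      rw [← constantCoeff_expSeries, expSeries_convExp hs, ← sub_eq_zero,
        ← map_one MvPowerSeries.constantCoeff, ← map_sub, hsub]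
      exact PowerSeries.constantCoeff_subst_eq_zero hc _ (by simp)
    rw [expSeries_convLog hexp, expSeries_convExp hs, hsub,
      ← PowerSeries.subst_comp_subst_apply PowerSeries.HasSubst.exp_sub_one ha,
      PowerSeries.log_subst_exp_sub_one, PowerSeries.subst_X ha]

end
end
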